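/- Let a, b, c > 0 be real and let K < 0 be real. Then (abc)^{1/2}-weighted contour integral identity: ∫_{−∞}^{∞} 1/((a − iγK)³ (b − iγ) √(c + iγ)) dγ = 2π/((a − bK)³ √(b + c)), where √ denotes the principal branch. -/

import Mathlib

open Complex MeasureTheory Real Filter Topology

lemma aux_zero (H : ℂ → ℂ) (hd : DifferentiableOn ℂ H {z | 0 ≤ z.re}) (C R0 : ℝ)
    (hR0 : 0 < R0) (hC : 0 ≤ C)
    (hb : ∀ z : ℂ, 0 ≤ z.re → R0 ≤ ‖z‖ → ‖H z‖ ≤ C / ‖z‖ ^ 2) :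
    Integrable (fun y : ℝ => H (y * I)) ∧ ∫ y : ℝ, H (y * I) = 0 := by
  have hcont : Continuous (fun y : ℝ => H (y * I)) := by
    have := hd.continuousOn.comp_continuous (f := fun y : ℝ => (y * I : ℂ)) (by fun_prop) (by simp)
    exact this
  have hint : Integrable (fun y : ℝ => H (y * I)) := by
    refine hcont.locallyIntegrable.integrable_of_isBigO_cocompact
      (g := fun y : ℝ => (1 + y ^ 2)⁻¹) ?_ (integrable_inv_one_add_sq.integrableAtFilter _)
    refine Asymptotics.IsBigO.of_bound (C * (1 + 1 / R0 ^ 2)) ?_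
    have h1 : ∀ᶠ y : ℝ in cocompact ℝ, R0 ≤ ‖y‖ :=
      (tendsto_norm_cocompact_atTop).eventually_ge_atTop R0
    filter_upwards [h1] with y hy
    have h2 := hb (y * I) (by simp) (by simpa using hy)
    have h3 : ‖(y * I : ℂ)‖ ^ 2 = y ^ 2 := by simp
    rw [h3] at h2
    have h4 : R0 ^ 2 ≤ y ^ 2 := by
      rw [← sq_abs y]; rw [Real.norm_eq_abs] at hy; gcongr
    have h5 : 0 < y ^ 2 := lt_of_lt_of_le (by positivity) h4
    rw [Real.norm_of_nonneg (by positivity)]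
    refine h2.trans ?_
    rw [mul_assoc, div_eq_mul_inv]
    gcongr
    rw [← div_eq_mul_inv, inv_eq_one_div, div_le_div_iff₀ h5 (by positivity)]
    have : 1 ≤ 1 / R0 ^ 2 * y ^ 2 := by
      rw [one_div, ← div_eq_inv_mul, le_div_iff₀ (by positivity)]; linarith
    linarith
  refine ⟨hint, ?_⟩
  have ht := intervalIntegral_tendsto_integral hint tendsto_neg_atTop_atBot tendsto_id
  refine tendsto_nhds_unique ht ?_
  have hlim : Tendsto (fun R : ℝ => 4 * C / R) atTop (𝓝 0) := tendsto_const_nhds.div_atTop tendsto_id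
  refine squeeze_zero_norm' ?_ hlim
  filter_upwards [eventually_ge_atTop R0] with R hR
  have hRp : 0 < R := hR0.trans_le hR
  have key : ∀ z : ℂ, 0 ≤ z.re → R ≤ ‖z‖ → ‖H z‖ ≤ C / R ^ 2 := fun z hz h =>
    (hb z hz (hR.trans h)).trans (by gcongr)
  have hrect := Complex.integral_boundary_rect_eq_zero_of_differentiableOn H (-R * I) (R + R * I)
    (hd.mono (by
      intro z hz
      have := hz.1
      simp [Set.uIcc_of_le hRp.le] at this
      exact this.1))
  simp at hrect
  have b1 : ‖∫ x in (0:ℝ)..R, H (x + -(R * I))‖ ≤ C / R ^ 2 * |R - 0| := by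
    apply intervalIntegral.norm_integral_le_of_norm_le_const
    intro x hx
    rw [Set.uIoc_of_le hRp.le] at hx
    apply key
    · simpa using hx.1.le
    · refine le_trans ?_ (Complex.abs_im_le_norm _)
      simp [abs_of_pos hRp]
  have b2 : ‖∫ x in (0:ℝ)..R, H (x + (R * I))‖ ≤ C / R ^ 2 * |R - 0| := by
    apply intervalIntegral.norm_integral_le_of_norm_le_const
    intro x hx
    rw [Set.uIoc_of_le hRp.le] at hx
    apply key
    · simpa using hx.1.le
    · refine le_trans ?_ (Complex.abs_im_le_norm _)
      simp [abs_of_pos hRp]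
  have b3 : ‖∫ x in (-R)..R, H (R + (x * I))‖ ≤ C / R ^ 2 * |R - -R| := by
    apply intervalIntegral.norm_integral_le_of_norm_le_const
    intro x hx
    apply key
    · simpa using hRp.le
    · refine le_trans ?_ (Complex.abs_re_le_norm _)
      simp [abs_of_pos hRp]
  simp only [id]
  have e : I * (∫ x in (-R)..R, H (x * I)) = (∫ x in (0:ℝ)..R, H (x + -(R * I))) -
      (∫ x in (0:ℝ)..R, H (x + (R * I))) + I * ∫ x in (-R)..R, H (R + (x * I)) := by
    linear_combination -hrect
  have e2 : ‖∫ x in (-R)..R, H (x * I)‖ = ‖I * (∫ x in (-R)..R, H (x * I))‖ := by simp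
  rw [e2, e]
  refine (norm_add_le _ _).trans ?_
  refine (add_le_add_left (norm_sub_le _ _) _).trans ?_
  rw [norm_mul, norm_I, one_mul]
  rw [abs_of_pos (by linarith)] at b1 b2 b3
  have : 4 * C / R = C / R ^ 2 * (R - 0) + C / R ^ 2 * (R - 0) + C / R ^ 2 * (R - -R) := by
    field_simp; ring
  linarith

lemma aux_k (b : ℝ) (hb : 0 < b) : Integrable (fun y : ℝ => 2 * b / (b ^ 2 + y ^ 2)) ∧
    ∫ y : ℝ, 2 * b / (b ^ 2 + y ^ 2) = 2 * π := by
  have e : (fun y : ℝ => 2 * b / (b ^ 2 + y ^ 2)) = fun y => 2 / b * (1 + (y / b) ^ 2)⁻¹ := by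
    ext y; field_simp
  rw [e]
  constructor
  · exact (integrable_inv_one_add_sq.comp_div hb.ne').const_mul _
  · rw [integral_const_mul, Measure.integral_comp_div (fun y : ℝ => (1 + y ^ 2)⁻¹) b,
      integral_univ_inv_one_add_sq, abs_of_pos hb, smul_eq_mul]
    field_simp

theorem contour_integral_neg_K (a b c K : ℝ) (ha : 0 < a) (hb : 0 < b)
    (hc : 0 < c) (hK : K < 0) :
    ∫ γ : ℝ,
        1 / (((a:ℂ) - Complex.I * γ * K) ^ 3 * ((b:ℂ) - Complex.I * γ) *
          ((c:ℂ) + Complex.I * γ) ^ ((1:ℂ)/2))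
      = ((2 * π / ((a - b * K) ^ 3 * Real.sqrt (b + c)) : ℝ) : ℂ) := by
  have reA : ∀ z : ℂ, 0 ≤ z.re → a ≤ ‖(a:ℂ) - z * K‖ := fun z hz => by
    refine le_trans ?_ (Complex.re_le_norm _)
    simp; nlinarith
  have nA : ∀ z : ℂ, 0 ≤ z.re → -K * ‖z‖ ≤ ‖(a:ℂ) - z * K‖ := fun z hz => by
    apply le_of_sq_le_sq _ (norm_nonneg _)
    rw [mul_pow, Complex.sq_norm, Complex.sq_norm, normSq_apply, normSq_apply]
    simp
    have : 0 ≤ a * (z.re * -K) := mul_nonneg ha.le (mul_nonneg hz (by linarith))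
    nlinarith
  have nB : ∀ z : ℂ, 0 ≤ z.re → ‖z‖ ≤ ‖(b:ℂ) + z‖ := fun z hz => by
    apply le_of_sq_le_sq _ (norm_nonneg _)
    rw [Complex.sq_norm, Complex.sq_norm, normSq_apply, normSq_apply]
    simp
    nlinarith [mul_nonneg hb.le hz]
  have nC : ∀ z : ℂ, 0 ≤ z.re → c ≤ ‖(c:ℂ) + z‖ := fun z hz => by
    refine le_trans ?_ (Complex.re_le_norm _)
    simp [hz]
  have nP : ∀ z : ℂ, 0 ≤ z.re → √c ≤ ‖((c:ℂ) + z) ^ ((1:ℂ)/2)‖ := fun z hz => by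
    have h0 : (c:ℂ) + z ≠ 0 := norm_pos_iff.1 (hc.trans_le (nC z hz))
    have : ((1:ℂ)/2) = ((1/2 : ℝ) : ℂ) := by simp
    rw [this, Complex.norm_cpow_real, ← Real.sqrt_eq_rpow]
    exact Real.sqrt_le_sqrt (nC z hz)
  have hsc : 0 < √c := Real.sqrt_pos.2 hc
  have A0 : ∀ z : ℂ, 0 ≤ z.re → (a:ℂ) - z * K ≠ 0 := fun z hz =>
    norm_pos_iff.1 (ha.trans_le (reA z hz))
  have P0 : ∀ z : ℂ, 0 ≤ z.re → ((c:ℂ) + z) ^ ((1:ℂ)/2) ≠ 0 := fun z hz =>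
    norm_pos_iff.1 (hsc.trans_le (nP z hz))
  have B0 : ∀ z : ℂ, 0 ≤ z.re → (b:ℂ) + z ≠ 0 := fun z hz h => by
    have := congrArg Complex.re h
    simp at this; linarith
  set g : ℂ → ℂ := fun z => 1 / (((a:ℂ) - z * K) ^ 3 * ((c:ℂ) + z) ^ ((1:ℂ)/2)) with hg
  set G : ℂ → ℂ := fun z => g z - g b * (2 * b) / (b + z) with hG
  have hbC : (b:ℂ) ≠ 0 := by exact_mod_cast hb.ne'
  have hGb : G b = 0 := by
    simp only [hG]; field_simp; ring
  have hgd : DifferentiableOn ℂ G {z | 0 ≤ z.re} := by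
    intro z hz
    apply DifferentiableAt.differentiableWithinAt
    have hs : (c:ℂ) + z ∈ slitPlane := Or.inl (by
      have : 0 ≤ z.re := hz
      simp; linarith)
    have d1 : DifferentiableAt ℂ (fun z : ℂ => ((c:ℂ) + z) ^ ((1:ℂ)/2)) z :=
      DifferentiableAt.cpow_const (by fun_prop) hs
    have d2 : DifferentiableAt ℂ g z := by
      apply DifferentiableAt.div (by fun_prop) (DifferentiableAt.mul (by fun_prop) d1)
      exact mul_ne_zero (pow_ne_zero _ (A0 z hz)) (P0 z hz)
    exact d2.sub (DifferentiableAt.div (by fun_prop) (by fun_prop) (B0 z hz))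
  have hnb : {z : ℂ | 0 ≤ z.re} ∈ 𝓝 (b:ℂ) := by
    filter_upwards [(isOpen_lt continuous_const Complex.continuous_re).mem_nhds
      (show (0:ℝ) < (b:ℂ).re by simpa using hb)] with z hz
    exact le_of_lt hz
  have hHd : DifferentiableOn ℂ (dslope G b) {z | 0 ≤ z.re} :=
    (Complex.differentiableOn_dslope hnb).2 hgd
  have hH : ∀ z : ℂ, z ≠ b → dslope G b z = G z / (z - b) := fun z hz => by
    rw [dslope_of_ne _ hz, slope_def_field, hGb, sub_zero]
  set D : ℝ := 1 / (a ^ 2 * (-K) * √c) + ‖g b * (2 * b)‖ with hD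
  have hK' : 0 < -K := by linarith
  have hDp : 0 ≤ D := by positivity
  obtain ⟨hi, h0⟩ := aux_zero (dslope G b) hHd (2 * D) (2 * b) (by positivity) (by positivity) (by
    intro z hz hzb
    have hzp : 0 < ‖z‖ := by linarith
    have hbn : ‖(b:ℂ)‖ = b := by simp [abs_of_pos hb]
    have hne : z ≠ b := by
      rintro rfl; rw [hbn] at hzb; linarith
    rw [hH z hne, norm_div]
    have h1 : ‖z‖ / 2 ≤ ‖z - b‖ := by
      have := norm_sub_norm_le z b
      rw [hbn] at this; linarith
    have h2 : ‖g z‖ ≤ 1 / (a ^ 2 * (-K) * √c) / ‖z‖ := by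
      simp only [hg]
      rw [norm_div, norm_one, norm_mul, norm_pow, div_div]
      have := reA z hz
      have := nA z hz
      have := nP z hz
      apply one_div_le_one_div_of_le (by positivity)
      calc a ^ 2 * (-K) * √c * ‖z‖ = a ^ 2 * (-K * ‖z‖) * √c := by ring
        _ ≤ ‖(a:ℂ) - z * K‖ ^ 2 * ‖(a:ℂ) - z * K‖ * ‖((c:ℂ) + z) ^ ((1:ℂ)/2)‖ := by gcongr
        _ = _ := by ring
    have h3 : ‖G z‖ ≤ D / ‖z‖ := by
      refine (norm_sub_le _ _).trans ?_
      rw [hD, add_div]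
      refine add_le_add h2 ?_
      rw [norm_div]
      have := nB z hz
      gcongr
    calc ‖G z‖ / ‖z - b‖ ≤ (D / ‖z‖) / (‖z‖ / 2) := by gcongr
      _ = _ := by field_simp)
  obtain ⟨ki, k0⟩ := aux_k b hb
  have hsplit : ∀ γ : ℝ, 1 / (((a:ℂ) - Complex.I * γ * K) ^ 3 * ((b:ℂ) - Complex.I * γ) *
          ((c:ℂ) + Complex.I * γ) ^ ((1:ℂ)/2)) =
      g b * ((2 * b / (b ^ 2 + γ ^ 2) : ℝ) : ℂ) - dslope G b (γ * I) := by
    intro γ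
    have hne : (γ * I : ℂ) ≠ b := fun h => by
      have := congrArg Complex.re h
      simp at this; linarith
    have hre : (0:ℝ) ≤ (γ * I : ℂ).re := by simp
    have s1 : (γ * I : ℂ) - b ≠ 0 := sub_ne_zero.2 hne
    have s2 := B0 _ hre
    have e1 : (((2 * b / (b ^ 2 + γ ^ 2) : ℝ)) : ℂ) = - (2 * b) / ((γ * I - b) * (b + γ * I)) := by
      have : ((b:ℂ) ^ 2 + γ ^ 2) = - ((γ * I - b) * (b + γ * I)) := by
        linear_combination (γ:ℂ)^2 * I_sq
      push_cast
      rw [this, div_neg, neg_div]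
    have e2 : 1 / (((a:ℂ) - Complex.I * γ * K) ^ 3 * ((b:ℂ) - Complex.I * γ) *
          ((c:ℂ) + Complex.I * γ) ^ ((1:ℂ)/2)) = - (g (γ * I) / (γ * I - b)) := by
      simp only [hg]
      rw [mul_comm I (γ:ℂ), ← neg_sub (γ * I : ℂ) (b:ℂ), div_div, ← div_neg]
      congr 1; ring
    rw [e1, e2, hH _ hne]
    simp only [hG]
    generalize g (γ * I) = u
    generalize g b = v
    field_simp
    ring
  have ki' : Integrable (fun y : ℝ => ((2 * b / (b ^ 2 + y ^ 2) : ℝ) : ℂ)) := ki.ofReal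
  have k0' : ∫ y : ℝ, ((2 * b / (b ^ 2 + y ^ 2) : ℝ) : ℂ) = ((2 * π : ℝ) : ℂ) := by
    rw [← k0]; exact integral_ofReal
  rw [integral_congr_ae (Eventually.of_forall hsplit),
    integral_sub (ki'.const_mul _) hi, h0, integral_const_mul, k0']
  have hs : ((c:ℂ) + b) ^ ((1:ℂ)/2) = ((√(b + c) : ℝ) : ℂ) := by
    rw [Real.sqrt_eq_rpow, Complex.ofReal_cpow (by positivity)]
    push_cast; rw [add_comm]
  simp only [hg, hs]
  push_cast
  ring
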